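/- arXiv:1508.06032 — 4 statements merged into one kernel-verified Lean document; each statement's English description precedes it below -/
import Mathlib

section
/- In the zero-sum sequential-move stopping game, with ρ*_σ := (ρ_σ, ρ̃) ∈ 𝔗^a_σ and τ*_σ := (τ_σ, τ̃) ∈ 𝔗^b_σ as constructed, for every type-A strategy ρ = (ρ_0, ρ_1) ∈ 𝔗^a_σ one has E_σ[U(ρ⟨τ*_σ⟩, τ*_σ⟨ρ⟩)] ≤ E_σ[U(ρ*_σ⟨τ*_σ⟩, τ*_σ⟨ρ*_σ⟩)] almost surely; together with the reverse inequality for deviations of the second player, (ρ*_σ, τ*_σ) is a saddle point of the game. -/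
open MeasureTheory Set

section

variable {Ω : Type*} {m0 : MeasurableSpace Ω} (μ : Measure Ω) (𝓕 : Filtration ℕ m0) (T : ℕ)

/-- `τ ∈ 𝒯`: a stopping time taking values in `{0,…,T}`. -/
def MemT (τ : Ω → ℕ) : Prop :=
  IsStoppingTime 𝓕 (fun ω => (τ ω : WithTop ℕ)) ∧ ∀ ω, τ ω ≤ T

/-- `τ ∈ 𝒯_t`: a stopping time with `τ ≥ t`. -/
def MemTge (t : ℕ) (τ : Ω → ℕ) : Prop :=
  MemT 𝓕 T τ ∧ ∀ ω, t ≤ τ ω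

/-- `τ ∈ 𝒯_{t+}`: a stopping time with `τ ≥ (t+1) ∧ T`. -/
def MemTgePlus (t : ℕ) (τ : Ω → ℕ) : Prop :=
  MemT 𝓕 T τ ∧ ∀ ω, min (t + 1) T ≤ τ ω

/-- `φ ∈ 𝕋^a`: `φ(t,·) ∈ 𝒯_{t+}` for every stage `t`. -/
def MemTTa (φ : ℕ → Ω → ℕ) : Prop :=
  ∀ t ≤ T, MemTgePlus 𝓕 T t (φ t)

/-- `ψ ∈ 𝕋^b`: `ψ(t,·) ∈ 𝒯_t` for every stage `t`. -/
def MemTTb (ψ : ℕ → Ω → ℕ) : Prop :=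
  ∀ t ≤ T, MemTge 𝓕 T t (ψ t)

/-- `ρ = (ρ₀,ρ₁) ∈ 𝔗^a`: a pure stopping strategy of type A. -/
def MemSA (ρ : (Ω → ℕ) × (ℕ → Ω → ℕ)) : Prop :=
  MemT 𝓕 T ρ.1 ∧ MemTTa 𝓕 T ρ.2

/-- `τ = (τ₀,τ₁) ∈ 𝔗^b`: a pure stopping strategy of type B. -/
def MemSB (τ : (Ω → ℕ) × (ℕ → Ω → ℕ)) : Prop :=
  MemT 𝓕 T τ.1 ∧ MemTTb 𝓕 T τ.2

/-- `ρ⟨τ⟩ = ρ₀ 1_{ρ₀ ≤ τ₀} + ρ₁(τ₀) 1_{ρ₀ > τ₀}`. -/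
def adjA (ρ τ : (Ω → ℕ) × (ℕ → Ω → ℕ)) : Ω → ℕ :=
  fun ω => if ρ.1 ω ≤ τ.1 ω then ρ.1 ω else ρ.2 (τ.1 ω) ω

/-- `τ⟨ρ⟩ = τ₀ 1_{τ₀ < ρ₀} + τ₁(ρ₀) 1_{τ₀ ≥ ρ₀}`. -/
def adjB (τ ρ : (Ω → ℕ) × (ℕ → Ω → ℕ)) : Ω → ℕ :=
  fun ω => if τ.1 ω < ρ.1 ω then τ.1 ω else τ.2 (ρ.1 ω) ω

/-- `w(ρ,τ) = E[U(ρ⟨τ⟩, τ⟨ρ⟩)]`: the payoff of the sequential-move stopping game. -/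
noncomputable def w (U : ℕ → ℕ → Ω → ℝ) (ρ τ : (Ω → ℕ) × (ℕ → Ω → ℕ)) : ℝ :=
  ∫ ω, U (adjA ρ τ ω) (adjB τ ρ ω) ω ∂μ

/-- `inf {t ≥ σ : P(t,·) holds}`, with the convention that the infimum is `T`
if there is no such `t` in `{0,…,T}`. -/
noncomputable def hitTime (T : ℕ) (σ : Ω → ℕ) (P : ℕ → Ω → Prop) : Ω → ℕ :=
  fun ω => sInf ({t | σ ω ≤ t ∧ P t ω} ∪ {T})

theorem aux_meas_comp {β : Type*} [MeasurableSpace β] (T : ℕ) (κ : Ω → ℕ) (hκ : Measurable κ)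
    (hκT : ∀ ω, κ ω ≤ T) (f : ℕ → Ω → β) (hf : ∀ t ≤ T, Measurable (f t)) :
    Measurable (fun ω => f (κ ω) ω) := by
  have h1 : Measurable (fun p : Ω × ℕ => f (min p.2 T) p.1) :=
    measurable_from_prod_countable_left (fun y => hf _ (min_le_right _ _))
  have h2 := h1.comp (measurable_id.prodMk hκ)
  have h3 : (fun ω => f (κ ω) ω) = (fun p : Ω × ℕ => f (min p.2 T) p.1) ∘ (fun ω => (id ω, κ ω)) := by
    funext ω
    simp [min_eq_left (hκT ω)]
  rw [h3]
  exact h2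

theorem aux_stop_le {κ : Ω → ℕ} (hκ : IsStoppingTime 𝓕 (fun ω => (κ ω : WithTop ℕ))) (t : ℕ) :
    MeasurableSet[𝓕 t] {ω | κ ω ≤ t} := by
  have := hκ.measurableSet_le t
  simpa using this

theorem aux_stop_eq {κ : Ω → ℕ} (hκ : IsStoppingTime 𝓕 (fun ω => (κ ω : WithTop ℕ))) (t : ℕ) :
    MeasurableSet[𝓕 t] {ω | κ ω = t} := by
  have := hκ.measurableSet_eq t
  simpa using this

theorem aux_stop_lt {κ : Ω → ℕ} (hκ : IsStoppingTime 𝓕 (fun ω => (κ ω : WithTop ℕ))) (t : ℕ) :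
    MeasurableSet[𝓕 t] {ω | t < κ ω} := by
  have h : {ω | t < κ ω} = {ω | κ ω ≤ t}ᶜ := by ext; simp
  rw [h]
  exact (aux_stop_le 𝓕 hκ t).compl

theorem aux_stop_ge {κ : Ω → ℕ} (hκ : IsStoppingTime 𝓕 (fun ω => (κ ω : WithTop ℕ))) (t : ℕ) :
    MeasurableSet[𝓕 t] {ω | t ≤ κ ω} := by
  have h : {ω | t ≤ κ ω} = {ω | t < κ ω} ∪ {ω | κ ω = t} := by
    ext; simp only [mem_ofPred_eq, mem_union]; omega
  rw [h]
  exact (aux_stop_lt 𝓕 hκ t).union (aux_stop_eq 𝓕 hκ t)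

theorem aux_stop_meas {κ : Ω → ℕ} (hκ : IsStoppingTime 𝓕 (fun ω => (κ ω : WithTop ℕ))) :
    Measurable κ := by
  refine measurable_to_countable' (fun t => ?_)
  exact 𝓕.le t _ (aux_stop_eq 𝓕 hκ t)

theorem aux_inter {σ : Ω → ℕ} (hσ : IsStoppingTime 𝓕 (fun ω => (σ ω : WithTop ℕ)))
    {A : Set Ω} (hA : MeasurableSet[hσ.measurableSpace] A) (t : ℕ) :
    MeasurableSet[𝓕 t] (A ∩ {ω | σ ω ≤ t}) := by
  have := ((hσ.measurableSet A).1 hA).2 t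
  simpa using this

theorem aux_int_comp (κ : Ω → ℕ) (hκ : Measurable κ) (hκT : ∀ ω, κ ω ≤ T) (v : ℕ → Ω → ℝ)
    (hv : ∀ t ≤ T, Integrable (v t) μ) : Integrable (fun ω => v (κ ω) ω) μ := by
  have h : (fun ω => v (κ ω) ω) =
      fun ω => ∑ t ∈ Finset.range (T + 1), ({ω | κ ω = t}).indicator (v t) ω := by
    funext ω
    rw [Finset.sum_eq_single (κ ω)]
    · simp
    · intro b _ hb
      simp [hb.symm]
    · intro h
      have := hκT ω
      simp at h
      omega
  rw [h]
  refine integrable_finsetSum _ (fun t ht => ?_)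
  have ht' : t ≤ T := by simp at ht; omega
  exact (hv t ht').indicator (hκ (measurableSet_singleton t))

theorem aux_step (v : ℕ → Ω → ℝ) (hv : ∀ t ≤ T, Integrable (v t) μ)
    (σ κ : Ω → ℕ) (hσ : IsStoppingTime 𝓕 (fun ω => (σ ω : WithTop ℕ)))
    (hκ : IsStoppingTime 𝓕 (fun ω => (κ ω : WithTop ℕ)))
    (hσκ : ∀ ω, σ ω ≤ κ ω) (hκT : ∀ ω, κ ω ≤ T)
    (hstep : ∀ t < T, ∀ B, MeasurableSet[𝓕 t] B → (∀ ω ∈ B, σ ω ≤ t ∧ t < κ ω) →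
      ∫ ω in B, v (t + 1) ω ∂μ ≤ ∫ ω in B, v t ω ∂μ)
    (A : Set Ω) (hA : MeasurableSet[hσ.measurableSpace] A) :
    ∫ ω in A, v (κ ω) ω ∂μ ≤ ∫ ω in A, v (σ ω) ω ∂μ := by
  have i1 := aux_int_comp μ T κ (aux_stop_meas 𝓕 hκ) hκT v hv
  have i2 := aux_int_comp μ T σ (aux_stop_meas 𝓕 hσ) (fun ω => (hσκ ω).trans (hκT ω)) v hv
  have hm : ∀ t, MeasurableSet[𝓕 t] {ω | σ ω ≤ t ∧ t < κ ω} := fun t =>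
    (aux_stop_le 𝓕 hσ t).inter (aux_stop_lt 𝓕 hκ t)
  have h : ∀ ω, v (κ ω) ω - v (σ ω) ω = ∑ t ∈ Finset.range T,
      ({ω | σ ω ≤ t ∧ t < κ ω}).indicator (fun ω => v (t + 1) ω - v t ω) ω := by
    intro ω
    rw [← Finset.sum_Ico_sub (fun t => v t ω) (hσκ ω)]
    simp only [Set.indicator_apply, mem_ofPred_eq]
    rw [← Finset.sum_filter]
    refine Finset.sum_congr ?_ (fun _ _ => rfl)
    ext t
    have := hκT ω
    simp only [Finset.mem_Ico, Finset.mem_filter, Finset.mem_range]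
    omega
  rw [← sub_nonpos, ← integral_sub i1.integrableOn i2.integrableOn]
  simp_rw [h]
  have hd : ∀ t ∈ Finset.range T, Integrable (fun ω => v (t + 1) ω - v t ω) μ := by
    intro t ht
    simp at ht
    exact (hv (t + 1) (by omega)).sub (hv t (by omega))
  rw [integral_finsetSum _ (fun t ht => ((hd t ht).indicator (𝓕.le t _ (hm t))).integrableOn)]
  refine Finset.sum_nonpos (fun t ht => ?_)
  rw [setIntegral_indicator (𝓕.le t _ (hm t))]
  simp at ht
  rw [integral_sub (hv (t + 1) (by omega)).integrableOn (hv t (by omega)).integrableOn, sub_nonpos]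
  refine hstep t ht _ ?_ (fun ω hω => hω.2)
  have : A ∩ {ω | σ ω ≤ t ∧ t < κ ω} = (A ∩ {ω | σ ω ≤ t}) ∩ {ω | t < κ ω} := by
    ext; simp only [mem_inter_iff, mem_ofPred_eq]; tauto
  rw [this]
  exact (aux_inter 𝓕 hσ hA t).inter (aux_stop_lt 𝓕 hκ t)

theorem aux_main (v : ℕ → Ω → ℝ) (hv : ∀ t ≤ T, Integrable (v t) μ)
    (X : Ω → ℝ) (hX : Integrable X μ)
    (σ α β : Ω → ℕ) (hσ : IsStoppingTime 𝓕 (fun ω => (σ ω : WithTop ℕ)))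
    (hα : IsStoppingTime 𝓕 (fun ω => (α ω : WithTop ℕ)))
    (hβ : IsStoppingTime 𝓕 (fun ω => (β ω : WithTop ℕ)))
    (hσα : ∀ ω, σ ω ≤ α ω) (hσβ : ∀ ω, σ ω ≤ β ω) (hαT : ∀ ω, α ω ≤ T)
    (hstep : ∀ t < T, ∀ B, MeasurableSet[𝓕 t] B → (∀ ω ∈ B, σ ω ≤ t ∧ t < α ω ∧ t < β ω) →
      ∫ ω in B, v (t + 1) ω ∂μ ≤ ∫ ω in B, v t ω ∂μ)
    (h1 : ∀ t ≤ T, ∀ B, MeasurableSet[𝓕 t] B → (∀ ω ∈ B, α ω = t ∧ t ≤ β ω) →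
      ∫ ω in B, X ω ∂μ ≤ ∫ ω in B, v t ω ∂μ)
    (h2 : ∀ t < T, ∀ B, MeasurableSet[𝓕 t] B → (∀ ω ∈ B, β ω = t ∧ t < α ω) →
      ∫ ω in B, X ω ∂μ ≤ ∫ ω in B, v t ω ∂μ)
    (A : Set Ω) (hA : MeasurableSet[hσ.measurableSpace] A) :
    ∫ ω in A, X ω ∂μ ≤ ∫ ω in A, v (σ ω) ω ∂μ := by
  have hκ : IsStoppingTime 𝓕 (fun ω => ((min (α ω) (β ω) : ℕ) : WithTop ℕ)) := by
    intro t
    have h : {ω | ((min (α ω) (β ω) : ℕ) : WithTop ℕ) ≤ t} = {ω | α ω ≤ t} ∪ {ω | β ω ≤ t} := by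
      ext ω
      simp only [mem_ofPred_eq, mem_union, Nat.cast_le]
      omega
    change MeasurableSet[𝓕 t] {ω | ((min (α ω) (β ω) : ℕ) : WithTop ℕ) ≤ t}
    rw [h]
    exact (aux_stop_le 𝓕 hα t).union (aux_stop_le 𝓕 hβ t)
  have hκT : ∀ ω, min (α ω) (β ω) ≤ T := fun ω => (min_le_left _ _).trans (hαT ω)
  refine le_trans ?_ (aux_step μ 𝓕 T v hv σ (fun ω => min (α ω) (β ω)) hσ hκ
    (fun ω => le_min (hσα ω) (hσβ ω)) hκT
    (fun t ht B hB hBs => hstep t ht B hB (fun ω hω => ?_)) A hA)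
  swap
  · have := hBs ω hω
    simp only [lt_min_iff] at this
    exact this
  have i1 := aux_int_comp μ T _ (aux_stop_meas 𝓕 hκ) hκT v hv
  have hAm : MeasurableSet A := hσ.measurableSpace_le _ hA
  have key : ∀ t ≤ T, ∀ B, MeasurableSet[𝓕 t] B → (∀ ω ∈ B, min (α ω) (β ω) = t) →
      ∫ ω in B, X ω ∂μ ≤ ∫ ω in B, v (min (α ω) (β ω)) ω ∂μ := by
    intro t ht B hB hBs
    have hBm := 𝓕.le t _ hB
    have hc : ∫ ω in B, v (min (α ω) (β ω)) ω ∂μ = ∫ ω in B, v t ω ∂μ :=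
      setIntegral_congr_fun hBm (fun ω hω => by simp only [hBs ω hω])
    rw [hc]
    have hm : MeasurableSet[𝓕 t] {ω | t < α ω} := aux_stop_lt 𝓕 hα t
    rw [← integral_inter_add_sdiff (𝓕.le t _ hm) hX.integrableOn,
      ← integral_inter_add_sdiff (f := v t) (𝓕.le t _ hm) (hv t ht).integrableOn]
    refine add_le_add ?_ ?_
    · rcases ht.lt_or_eq with ht' | ht'
      · refine h2 t ht' _ (hB.inter hm) (fun ω hω => ?_)
        have e1 := hBs ω hω.1
        have e2 : t < α ω := hω.2
        omega
      · have : B ∩ {ω | t < α ω} = ∅ := by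
          ext ω
          have := hαT ω
          simp only [mem_inter_iff, mem_ofPred_eq, mem_empty_iff_false, iff_false]
          omega
        rw [this]
        simp
    · refine h1 t ht _ (hB.diff hm) (fun ω hω => ?_)
      have e1 := hBs ω hω.1
      have e2 : ¬ t < α ω := hω.2
      omega
  have hAU : A = ⋃ t ∈ Finset.range (T + 1), A ∩ {ω | min (α ω) (β ω) = t} := by
    ext ω
    have := hκT ω
    simp only [mem_iUnion, mem_inter_iff, mem_ofPred_eq, Finset.mem_range, exists_prop]
    constructor
    · intro h
      exact ⟨_, by omega, h, rfl⟩
    · rintro ⟨_, _, h, _⟩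
      exact h
  have hmeas : ∀ t, MeasurableSet[𝓕 t] (A ∩ {ω | min (α ω) (β ω) = t}) := by
    intro t
    have : A ∩ {ω | min (α ω) (β ω) = t} =
        (A ∩ {ω | σ ω ≤ t}) ∩ {ω | min (α ω) (β ω) = t} := by
      ext ω
      have a1 := hσα ω
      have a2 := hσβ ω
      simp only [mem_inter_iff, mem_ofPred_eq]
      constructor
      · rintro ⟨h, h'⟩
        exact ⟨⟨h, by omega⟩, h'⟩
      · rintro ⟨⟨h, _⟩, h'⟩
        exact ⟨h, h'⟩
    rw [this]
    exact (aux_inter 𝓕 hσ hA t).inter (aux_stop_eq 𝓕 hκ t)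
  have hdisj : Set.Pairwise (↑(Finset.range (T + 1)))
      (Function.onFun Disjoint (fun t => A ∩ {ω | min (α ω) (β ω) = t})) := by
    intro s _ t _ hst
    refine Set.disjoint_left.2 (fun ω hs ht => hst ?_)
    exact hs.2.symm.trans ht.2
  rw [hAU, integral_biUnion_finset _ (fun t _ => 𝓕.le t _ (hmeas t)) hdisj
      (fun t _ => hX.integrableOn),
    integral_biUnion_finset _ (fun t _ => 𝓕.le t _ (hmeas t)) hdisj
      (fun t _ => i1.integrableOn)]
  refine Finset.sum_le_sum (fun t ht => key t (by simp at ht; omega) _ (hmeas t) (fun ω hω => hω.2))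

theorem aux_condExp_le [IsFiniteMeasure μ] {m : MeasurableSpace Ω} (hm : m ≤ m0) {X Y : Ω → ℝ}
    (hX : Integrable X μ) (hY : Integrable Y μ)
    (h : ∀ A, MeasurableSet[m] A → ∫ ω in A, X ω ∂μ ≤ ∫ ω in A, Y ω ∂μ) :
    μ[X | m] ≤ᵐ[μ] μ[Y | m] := by
  refine ae_le_of_ae_le_trim (hm := hm) ?_
  refine ae_le_of_forall_setIntegral_le
    (integrable_condExp.trim hm stronglyMeasurable_condExp)
    (integrable_condExp.trim hm stronglyMeasurable_condExp) (fun s hs _ => ?_)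
  rw [← setIntegral_trim hm stronglyMeasurable_condExp hs,
    ← setIntegral_trim hm stronglyMeasurable_condExp hs,
    setIntegral_condExp hm hX hs, setIntegral_condExp hm hY hs]
  exact h s hs

theorem aux_hit_stop (σ : Ω → ℕ) (hσ : IsStoppingTime 𝓕 (fun ω => (σ ω : WithTop ℕ)))
    (P : ℕ → Ω → Prop) (hP : ∀ t ≤ T, MeasurableSet[𝓕 t] {ω | P t ω}) :
    IsStoppingTime 𝓕 (fun ω => (hitTime T σ P ω : WithTop ℕ)) := by
  intro t
  have h0 : {ω | (hitTime T σ P ω : WithTop ℕ) ≤ t} = {ω | hitTime T σ P ω ≤ t} := by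
    ext; simp
  change MeasurableSet[𝓕 t] {ω | (hitTime T σ P ω : WithTop ℕ) ≤ t}
  rw [h0]
  by_cases ht : T ≤ t
  · have : {ω | hitTime T σ P ω ≤ t} = univ := by
      ext ω
      simp only [mem_ofPred_eq, mem_univ, iff_true]
      exact (Nat.sInf_le (by simp)).trans ht
    rw [this]
    exact MeasurableSet.univ
  · have : {ω | hitTime T σ P ω ≤ t} = ⋃ s ∈ Finset.range (t + 1), ({ω | σ ω ≤ s} ∩ {ω | P s ω}) := by
      ext ω
      simp only [mem_ofPred_eq, mem_iUnion, Finset.mem_range, exists_prop, mem_inter_iff]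
      constructor
      · intro h
        have hne : ({s | σ ω ≤ s ∧ P s ω} ∪ {T}).Nonempty := ⟨T, by simp⟩
        rcases Nat.sInf_mem hne with hh | hh
        · exact ⟨hitTime T σ P ω, by omega, hh⟩
        · have hh' : hitTime T σ P ω = T := hh
          omega
      · rintro ⟨s, hs, hh⟩
        have : hitTime T σ P ω ≤ s := Nat.sInf_le (Or.inl hh)
        omega
    rw [this]
    refine Finset.measurableSet_biUnion _ (fun s hs => ?_)
    have hs' : s ≤ t := by simp at hs; omega
    exact 𝓕.mono hs' _ ((aux_stop_le 𝓕 hσ s).inter (hP s (by omega)))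

theorem aux_hit_le (σ : Ω → ℕ) (P : ℕ → Ω → Prop) (ω : Ω) : hitTime T σ P ω ≤ T :=
  Nat.sInf_le (by simp)

theorem aux_hit_spec (σ : Ω → ℕ) (P : ℕ → Ω → Prop) (ω : Ω) (h : hitTime T σ P ω < T) :
    P (hitTime T σ P ω) ω := by
  have hne : ({s | σ ω ≤ s ∧ P s ω} ∪ {T}).Nonempty := ⟨T, by simp⟩
  rcases Nat.sInf_mem hne with hh | hh
  · exact hh.2
  · have hh' : hitTime T σ P ω = T := hh
    omega

theorem aux_hit_ge (σ : Ω → ℕ) (hσT : ∀ ω, σ ω ≤ T) (P : ℕ → Ω → Prop) (ω : Ω) :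
    σ ω ≤ hitTime T σ P ω := by
  have hne : ({s | σ ω ≤ s ∧ P s ω} ∪ {T}).Nonempty := ⟨T, by simp⟩
  rcases Nat.sInf_mem hne with hh | hh
  · exact hh.1
  · have hh' : hitTime T σ P ω = T := hh
    rw [hh']
    exact hσT ω

theorem aux_hit_not (σ : Ω → ℕ) (P : ℕ → Ω → Prop) (ω : Ω) (t : ℕ) (h : t < hitTime T σ P ω)
    (ht : σ ω ≤ t) : ¬ P t ω := by
  intro hP
  have : hitTime T σ P ω ≤ t := Nat.sInf_le (Or.inl ⟨ht, hP⟩)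
  omega

/-- in the zero-sum sequential-move stopping game, for every
type-A strategy `ρ ∈ 𝔗^a_σ`, the conditional payoff against the constructed
strategy `τ*_σ = (τ_σ, τ̃)` is dominated by the equilibrium conditional payoff:
`E_σ[U(ρ⟨τ*_σ⟩, τ*_σ⟨ρ⟩)] ≤ E_σ[U(ρ*_σ⟨τ*_σ⟩, τ*_σ⟨ρ*_σ⟩)]` a.s.
(together with the second-player inequality this makes `(ρ*_σ, τ*_σ)` a saddle
point of the game). -/
theorem zero_sum_saddle_first_player_deviation
    [MeasurableSpace.CountablyGenerated Ω] [IsProbabilityMeasure μ]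
    (U : ℕ → ℕ → Ω → ℝ)
    (hUm : ∀ s t, Measurable[𝓕 (max s t)] (U s t))
    (hUb : ∃ C, ∀ s t ω, |U s t ω| ≤ C)
    -- stage-wise optimizers `ρ̃(t) ∈ 𝒯_{t+}` and `τ̃(t) ∈ 𝒯_t`
    (ρtil τtil : ℕ → Ω → ℕ)
    (hρtil : ∀ t ≤ T, MemTgePlus 𝓕 T t (ρtil t))
    (hτtil : ∀ t ≤ T, MemTge 𝓕 T t (τtil t))
    (hρopt : ∀ t ≤ T, ∀ ξ : Ω → ℕ, MemTgePlus 𝓕 T t ξ →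
      μ[fun ω => U (ξ ω) t ω | 𝓕 t] ≤ᵐ[μ] μ[fun ω => U (ρtil t ω) t ω | 𝓕 t])
    (hτopt : ∀ t ≤ T, ∀ ξ : Ω → ℕ, MemTge 𝓕 T t ξ →
      μ[fun ω => U t (τtil t ω) ω | 𝓕 t] ≤ᵐ[μ] μ[fun ω => U t (ξ ω) ω | 𝓕 t])
    -- `F_t = E_t[U(t,τ̃(t))]`, `G_t = E_t[U(ρ̃(t),t)] ∨ F_t`
    (F G v : ℕ → Ω → ℝ)
    (hF : ∀ t, F t = μ[fun ω => U t (τtil t ω) ω | 𝓕 t])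
    (hG : ∀ t, G t = fun ω => max ((μ[fun ω' => U (ρtil t ω') t ω' | 𝓕 t]) ω) (F t ω))
    -- the value process, by backward recursion
    (hvT : v T = F T)
    (hvrec : ∀ t < T, v t = fun ω => max (F t ω) (min (G t ω) ((μ[v (t + 1) | 𝓕 t]) ω)))
    -- the initial stage `σ ∈ 𝒯`
    (σ : Ω → ℕ) (hσ : IsStoppingTime 𝓕 (fun ω => (σ ω : WithTop ℕ))) (hσT : ∀ ω, σ ω ≤ T)
    -- `ρ_σ = inf{t ≥ σ : v_t = F_t}` and `τ_σ = inf{t ≥ σ : v_t = G_t}`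
    (ρσ τσ : Ω → ℕ)
    (hρσ : ρσ = hitTime T σ (fun t ω => v t ω = F t ω))
    (hτσ : τσ = hitTime T σ (fun t ω => v t ω = G t ω))
    -- an arbitrary deviation `ρ ∈ 𝔗^a_σ` of the first player
    (ρ : (Ω → ℕ) × (ℕ → Ω → ℕ)) (hρ : MemSA 𝓕 T ρ) (hρge : ∀ ω, σ ω ≤ ρ.1 ω) :
    μ[fun ω => U (adjA ρ (τσ, τtil) ω) (adjB (τσ, τtil) ρ ω) ω
        | hσ.measurableSpace] ≤ᵐ[μ]
    μ[fun ω => U (adjA (ρσ, ρtil) (τσ, τtil) ω) (adjB (τσ, τtil) (ρσ, ρtil) ω) ω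
        | hσ.measurableSpace] := by
  obtain ⟨C, hC⟩ := hUb
  obtain ⟨⟨hρ0, hρ0T⟩, hρ1⟩ := hρ
  -- integrability of payoffs
  have hUint : ∀ f g : Ω → ℕ, Measurable f → Measurable g → (∀ ω, f ω ≤ T) → (∀ ω, g ω ≤ T) →
      Integrable (fun ω => U (f ω) (g ω) ω) μ := by
    intro f g hf hg hfT hgT
    have hmeas : Measurable (fun ω => U (f ω) (g ω) ω) :=
      aux_meas_comp T f hf hfT (fun s ω => U s (g ω) ω)
        (fun s _ => aux_meas_comp T g hg hgT (U s) (fun t _ => (hUm s t).mono (𝓕.le _) le_rfl))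
    exact Integrable.of_bound hmeas.aestronglyMeasurable C
      (Filter.Eventually.of_forall (fun ω => hC _ _ _))
  have hUF : ∀ t ≤ T, Integrable (fun ω => U t (τtil t ω) ω) μ := fun t ht =>
    hUint (fun _ => t) (τtil t) measurable_const (aux_stop_meas 𝓕 (hτtil t ht).1.1)
      (fun _ => ht) (hτtil t ht).1.2
  have hUG : ∀ t ≤ T, ∀ ξ, MemTgePlus 𝓕 T t ξ → Integrable (fun ω => U (ξ ω) t ω) μ :=
    fun t ht ξ hξ => hUint ξ (fun _ => t) (aux_stop_meas 𝓕 hξ.1.1) measurable_const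
      hξ.1.2 (fun _ => ht)
  -- measurability and integrability of F, G, v
  have hFm : ∀ t, Measurable[𝓕 t] (F t) := fun t => by
    rw [hF t]; exact stronglyMeasurable_condExp.measurable
  have hGm : ∀ t, Measurable[𝓕 t] (G t) := fun t => by
    rw [hG t]; exact stronglyMeasurable_condExp.measurable.max (hFm t)
  have hvm : ∀ t ≤ T, Measurable[𝓕 t] (v t) := fun t ht => by
    rcases ht.lt_or_eq with h | h
    · rw [hvrec t h]
      exact (hFm t).max ((hGm t).min stronglyMeasurable_condExp.measurable)
    · subst h
      rw [hvT]
      exact hFm t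
  have hFi : ∀ t, Integrable (F t) μ := fun t => by
    rw [hF t]; exact integrable_condExp
  have hGi : ∀ t, Integrable (G t) μ := fun t => by
    rw [hG t]; exact integrable_condExp.sup (hFi t)
  have hvi : ∀ t ≤ T, Integrable (v t) μ := fun t ht => by
    rcases ht.lt_or_eq with h | h
    · rw [hvrec t h]
      exact (hFi t).sup ((hGi t).inf integrable_condExp)
    · subst h
      rw [hvT]
      exact hFi t
  have hFv : ∀ t ≤ T, ∀ ω, F t ω ≤ v t ω := fun t ht ω => by
    rcases ht.lt_or_eq with h | h
    · rw [hvrec t h]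
      exact le_max_left _ _
    · subst h
      rw [hvT]
  have hFG : ∀ t ω, F t ω ≤ G t ω := fun t ω => by
    rw [hG t]; exact le_max_right _ _
  have hρs : IsStoppingTime 𝓕 (fun ω => (ρσ ω : WithTop ℕ)) := by
    rw [hρσ]
    exact aux_hit_stop 𝓕 T σ hσ _ (fun t ht => measurableSet_eq_fun (hvm t ht) (hFm t))
  have hτs : IsStoppingTime 𝓕 (fun ω => (τσ ω : WithTop ℕ)) := by
    rw [hτσ]
    exact aux_hit_stop 𝓕 T σ hσ _ (fun t ht => measurableSet_eq_fun (hvm t ht) (hGm t))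
  have hρT : ∀ ω, ρσ ω ≤ T := fun ω => by rw [hρσ]; exact aux_hit_le T σ _ ω
  have hτT : ∀ ω, τσ ω ≤ T := fun ω => by rw [hτσ]; exact aux_hit_le T σ _ ω
  have hσρ : ∀ ω, σ ω ≤ ρσ ω := fun ω => by rw [hρσ]; exact aux_hit_ge T σ hσT _ ω
  have hστ : ∀ ω, σ ω ≤ τσ ω := fun ω => by rw [hτσ]; exact aux_hit_ge T σ hσT _ ω
  have hρhit : ∀ ω, v (ρσ ω) ω = F (ρσ ω) ω := fun ω => by
    rcases (hρT ω).lt_or_eq with h | h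
    · rw [hρσ] at h ⊢
      exact aux_hit_spec T σ _ ω h
    · rw [h, hvT]
  have hτhit : ∀ ω, τσ ω < T → v (τσ ω) ω = G (τσ ω) ω := fun ω h => by
    rw [hτσ] at h ⊢
    exact aux_hit_spec T σ _ ω h
  have hρnot : ∀ ω t, σ ω ≤ t → t < ρσ ω → v t ω ≠ F t ω := fun ω t h1 h2 => by
    rw [hρσ] at h2
    exact aux_hit_not T σ _ ω t h2 h1
  have hτnot : ∀ ω t, σ ω ≤ t → t < τσ ω → v t ω ≠ G t ω := fun ω t h1 h2 => by
    rw [hτσ] at h2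
    exact aux_hit_not T σ _ ω t h2 h1
  -- integrability of the two payoffs
  have hXint : ∀ ρ' : (Ω → ℕ) × (ℕ → Ω → ℕ), IsStoppingTime 𝓕 (fun ω => (ρ'.1 ω : WithTop ℕ)) →
      (∀ ω, ρ'.1 ω ≤ T) → MemTTa 𝓕 T ρ'.2 →
      Integrable (fun ω => U (adjA ρ' (τσ, τtil) ω) (adjB (τσ, τtil) ρ' ω) ω) μ := by
    intro ρ' h1 h2 h3
    have m1 := aux_stop_meas 𝓕 h1
    have m2 := aux_stop_meas 𝓕 hτs
    refine hUint _ _ ?_ ?_ ?_ ?_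
    · exact Measurable.ite (measurableSet_le m1 m2) m1
        (aux_meas_comp T τσ m2 hτT ρ'.2 (fun t ht => aux_stop_meas 𝓕 (h3 t ht).1.1))
    · exact Measurable.ite (measurableSet_lt m2 m1) m2
        (aux_meas_comp T ρ'.1 m1 h2 τtil (fun t ht => aux_stop_meas 𝓕 (hτtil t ht).1.1))
    · intro ω
      simp only [adjA]
      split_ifs
      · exact h2 ω
      · exact (h3 _ (hτT ω)).1.2 ω
    · intro ω
      simp only [adjB]
      split_ifs
      · exact hτT ω
      · exact (hτtil _ (h2 ω)).1.2 ω
  -- the payoff on the two events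
  have hpay1 : ∀ ρ' : (Ω → ℕ) × (ℕ → Ω → ℕ), ∀ t ≤ T, ∀ B, MeasurableSet[𝓕 t] B →
      (∀ ω ∈ B, ρ'.1 ω = t ∧ t ≤ τσ ω) →
      ∫ ω in B, U (adjA ρ' (τσ, τtil) ω) (adjB (τσ, τtil) ρ' ω) ω ∂μ = ∫ ω in B, F t ω ∂μ := by
    intro ρ' t ht B hB hBs
    rw [hF t, setIntegral_condExp (𝓕.le t) (hUF t ht) hB]
    refine setIntegral_congr_fun (𝓕.le t _ hB) (fun ω hω => ?_)
    obtain ⟨e1, e2⟩ := hBs ω hω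
    simp only [adjA, adjB, e1, if_pos e2, if_neg (not_lt.2 e2)]
  have hpay2 : ∀ ρ' : (Ω → ℕ) × (ℕ → Ω → ℕ), MemTTa 𝓕 T ρ'.2 → ∀ t ≤ T, ∀ B,
      MeasurableSet[𝓕 t] B → (∀ ω ∈ B, τσ ω = t ∧ t < ρ'.1 ω) →
      ∫ ω in B, U (adjA ρ' (τσ, τtil) ω) (adjB (τσ, τtil) ρ' ω) ω ∂μ =
        ∫ ω in B, (μ[fun ω => U (ρ'.2 t ω) t ω | 𝓕 t]) ω ∂μ := by
    intro ρ' h3 t ht B hB hBs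
    rw [setIntegral_condExp (𝓕.le t) (hUG t ht _ (h3 t ht)) hB]
    refine setIntegral_congr_fun (𝓕.le t _ hB) (fun ω hω => ?_)
    obtain ⟨e1, e2⟩ := hBs ω hω
    simp only [adjA, adjB, e1, if_pos e2, if_neg (not_le.2 e2)]
  have hXi := hXint ρ hρ0 hρ0T hρ1
  have hYi := hXint (ρσ, ρtil) hρs hρT hρtil
  refine aux_condExp_le μ hσ.measurableSpace_le hXi hYi (fun A hA => ?_)
  have hle : ∫ ω in A, U (adjA ρ (τσ, τtil) ω) (adjB (τσ, τtil) ρ ω) ω ∂μ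
      ≤ ∫ ω in A, v (σ ω) ω ∂μ := by
    refine aux_main μ 𝓕 T v hvi _ hXi σ ρ.1 τσ hσ hρ0 hτs hρge hστ hρ0T ?_ ?_ ?_ A hA
    · intro t ht B hB hBs
      rw [← setIntegral_condExp (𝓕.le t) (hvi (t + 1) ht) hB]
      refine setIntegral_mono_on integrable_condExp.integrableOn (hvi t ht.le).integrableOn
        (𝓕.le t _ hB) (fun ω hω => ?_)
      obtain ⟨e1, _, e3⟩ := hBs ω hω
      have hn := hτnot ω t e1 e3
      have hr := congrFun (hvrec t ht) ω
      have hfg := hFG t ω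
      grind
    · intro t ht B hB hBs
      rw [hpay1 ρ t ht B hB hBs]
      exact setIntegral_mono (hFi t).integrableOn (hvi t ht).integrableOn (hFv t ht)
    · intro t ht B hB hBs
      rw [hpay2 ρ hρ1 t ht.le B hB (fun ω hω => hBs ω hω)]
      refine setIntegral_mono_on_ae integrable_condExp.integrableOn (hvi t ht.le).integrableOn
        (𝓕.le t _ hB) ?_
      filter_upwards [hρopt t ht.le _ (hρ1 t ht.le)] with ω hω hωB
      obtain ⟨e1, e2⟩ := hBs ω hωB
      have hh := hτhit ω (by omega)
      rw [e1] at hh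
      rw [hh, hG t]
      exact hω.trans (le_max_left _ _)
  have hge : ∫ ω in A, -(U (adjA (ρσ, ρtil) (τσ, τtil) ω) (adjB (τσ, τtil) (ρσ, ρtil) ω) ω) ∂μ
      ≤ ∫ ω in A, -(v (σ ω) ω) ∂μ := by
    refine aux_main μ 𝓕 T (fun t ω => -(v t ω)) (fun t ht => (hvi t ht).neg) _ hYi.neg σ ρσ τσ
      hσ hρs hτs hσρ hστ hρT ?_ ?_ ?_ A hA
    · intro t ht B hB hBs
      rw [integral_neg, integral_neg, neg_le_neg_iff]
      rw [← setIntegral_condExp (f := v (t + 1)) (𝓕.le t) (hvi (t + 1) ht) hB]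
      refine setIntegral_mono_on (hvi t ht.le).integrableOn integrable_condExp.integrableOn
        (𝓕.le t _ hB) (fun ω hω => ?_)
      obtain ⟨e1, e2, e3⟩ := hBs ω hω
      have hn := hτnot ω t e1 e3
      have hn' := hρnot ω t e1 e2
      have hr := congrFun (hvrec t ht) ω
      have hfg := hFG t ω
      grind
    · intro t ht B hB hBs
      simp only [Pi.neg_apply]
      rw [integral_neg, integral_neg, neg_le_neg_iff]
      rw [hpay1 (ρσ, ρtil) t ht B hB hBs]
      refine le_of_eq (setIntegral_congr_fun (𝓕.le t _ hB) (fun ω hω => ?_))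
      have := hρhit ω
      rwa [(hBs ω hω).1] at this
    · intro t ht B hB hBs
      simp only [Pi.neg_apply]
      rw [integral_neg, integral_neg, neg_le_neg_iff]
      rw [hpay2 (ρσ, ρtil) hρtil t ht.le B hB hBs]
      refine le_of_eq (setIntegral_congr_fun (𝓕.le t _ hB) (fun ω hω => ?_))
      obtain ⟨e1, e2⟩ := hBs ω hω
      have hh := hτhit ω (by omega)
      have hs := hστ ω
      rw [e1] at hh hs
      have hn' := hρnot ω t hs e2
      have hg := congrFun (hG t) ω
      change v t ω = (μ[fun ω => U (ρtil t ω) t ω | 𝓕 t]) ω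
      grind
  rw [integral_neg, integral_neg, neg_le_neg_iff] at hge
  exact hle.trans hge

end
end

section
/- The zero-sum sequential-move stopping game has a value: sup over ρ ∈ 𝔗^a of inf over τ ∈ 𝔗^b of E[U(ρ⟨τ⟩, τ⟨ρ⟩)] equals inf over τ ∈ 𝔗^b of sup over ρ ∈ 𝔗^a of E[U(ρ⟨τ⟩, τ⟨ρ⟩)]. -/
open MeasureTheory Set

section

variable {Ω : Type*} {m0 : MeasurableSpace Ω} (μ : Measure Ω) (𝓕 : Filtration ℕ m0) (T : ℕ)

/-- Outcome of a Dynkin game in which player A moves first. -/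
def dynkinJ (X Y : ℕ → Ω → ℝ) (ρ τ : Ω → ℕ) : Ω → ℝ :=
  fun ω => if ρ ω ≤ τ ω then X (ρ ω) ω else Y (τ ω) ω

theorem memT_iff (τ : Ω → ℕ) :
    MemT 𝓕 T τ ↔ (∀ i, MeasurableSet[𝓕 i] {ω | τ ω ≤ i}) ∧ ∀ ω, τ ω ≤ T := by
  unfold MemT IsStoppingTime
  have : ∀ i : ℕ, {ω | ((τ ω : ℕ) : WithTop ℕ) ≤ (i : WithTop ℕ)} = {ω | τ ω ≤ i} := by
    intro i; ext ω; simp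
  constructor
  · rintro ⟨h, h'⟩
    refine ⟨fun i => ?_, h'⟩
    rw [← this i]; exact h i
  · rintro ⟨h, h'⟩
    refine ⟨fun i => ?_, h'⟩
    have h2 := h i
    rw [← this i] at h2
    exact h2

theorem memT_const (r : ℕ) (hr : r ≤ T) : MemT 𝓕 T (fun _ => r) := by
  rw [memT_iff]
  exact ⟨fun i => MeasurableSet.const _, fun _ => hr⟩

theorem memT_gt {τ : Ω → ℕ} (h : MemT 𝓕 T τ) (i : ℕ) : MeasurableSet[𝓕 i] {ω | i < τ ω} := by
  have := (((memT_iff 𝓕 T τ).1 h).1 i).compl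
  convert this using 1
  ext ω; simp

theorem memT_eq {τ : Ω → ℕ} (h : MemT 𝓕 T τ) (i : ℕ) : MeasurableSet[𝓕 i] {ω | τ ω = i} := by
  have h1 := ((memT_iff 𝓕 T τ).1 h).1
  rcases i with _ | i
  · convert h1 0 using 1
    ext ω; simp
  · have h2 := (h1 (i+1)).diff (𝓕.mono (Nat.le_succ i) _ (h1 i))
    convert h2 using 1
    ext ω; simp; omega

theorem memT_measurable {τ : Ω → ℕ} (h : MemT 𝓕 T τ) : Measurable τ :=
  measurable_to_countable' fun i => 𝓕.le i _ (memT_eq 𝓕 T h i)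

theorem memT_max {τ : Ω → ℕ} (h : MemT 𝓕 T τ) (r : ℕ) (hr : r ≤ T) :
    MemT 𝓕 T (fun ω => max (τ ω) r) := by
  rw [memT_iff] at h ⊢
  refine ⟨fun i => ?_, fun ω => max_le (h.2 ω) hr⟩
  by_cases hi : r ≤ i
  · convert h.1 i using 1
    ext ω; simp [hi]
  · convert MeasurableSet.empty using 1
    ext ω; simp; omega

open Classical in
theorem memT_ite {τ : Ω → ℕ} {r : ℕ} (hr : r ≤ T) (h : MemTge 𝓕 T (r+1) τ) {S : Set Ω}
    (hS : MeasurableSet[𝓕 r] S) : MemTge 𝓕 T r (fun ω => if ω ∈ S then r else τ ω) := by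
  obtain ⟨h, hge⟩ := h
  rw [memT_iff] at h
  refine ⟨(memT_iff _ _ _).2 ⟨fun i => ?_, fun ω => ?_⟩, fun ω => ?_⟩
  · by_cases hi : r ≤ i
    · have hS' := 𝓕.mono hi _ hS
      convert hS'.union (h.1 i) using 1
      ext ω
      have := hge ω
      by_cases hω : ω ∈ S <;> simp [hω, hi]
    · convert MeasurableSet.empty using 1
      ext ω
      have := hge ω
      by_cases hω : ω ∈ S <;> simp [hω] <;> omega
  · have := h.2 ω
    by_cases hω : ω ∈ S <;> simp [hω] <;> omega
  · have := hge ω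
    by_cases hω : ω ∈ S <;> simp [hω]; omega

theorem integrable_comp (F : ℕ → ℕ → Ω → ℝ) (hF : ∀ s ≤ T, ∀ t ≤ T, Integrable (F s t) μ)
    {ρ τ : Ω → ℕ} (hρ : Measurable ρ) (hρT : ∀ ω, ρ ω ≤ T) (hτ : Measurable τ)
    (hτT : ∀ ω, τ ω ≤ T) : Integrable (fun ω => F (ρ ω) (τ ω) ω) μ := by
  have h : (fun ω => F (ρ ω) (τ ω) ω) = fun ω => ∑ s ∈ Finset.range (T+1),
      ∑ t ∈ Finset.range (T+1), (ρ ⁻¹' {s} ∩ τ ⁻¹' {t}).indicator (F s t) ω := by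
    funext ω
    rw [Finset.sum_eq_single (ρ ω), Finset.sum_eq_single (τ ω)]
    · simp
    · intro b _ hb
      apply Set.indicator_of_notMem
      simp [Ne.symm hb]
    · intro hb; exact absurd (Finset.mem_range.2 (Nat.lt_succ_of_le (hτT ω))) hb
    · intro b _ hb
      apply Finset.sum_eq_zero
      intro t _
      apply Set.indicator_of_notMem
      simp [Ne.symm hb]
    · intro hb; exact absurd (Finset.mem_range.2 (Nat.lt_succ_of_le (hρT ω))) hb
  rw [h]
  refine integrable_finset_sum _ fun s hs => integrable_finset_sum _ fun t ht => ?_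
  refine (hF s (Nat.lt_succ_iff.1 (Finset.mem_range.1 hs)) t
    (Nat.lt_succ_iff.1 (Finset.mem_range.1 ht))).indicator ?_
  exact (hρ (measurableSet_singleton s)).inter (hτ (measurableSet_singleton t))

theorem integrable_dynkinJ {X Y : ℕ → Ω → ℝ} (hX : ∀ s ≤ T, Integrable (X s) μ)
    (hY : ∀ s ≤ T, Integrable (Y s) μ) {ρ τ : Ω → ℕ} (hρ : MemT 𝓕 T ρ) (hτ : MemT 𝓕 T τ) :
    Integrable (dynkinJ X Y ρ τ) μ := by
  have := integrable_comp μ T (fun s t ω => if s ≤ t then X s ω else Y t ω) (by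
    intro s hs t ht
    by_cases h : s ≤ t
    · simpa [h] using hX s hs
    · simpa [h] using hY t ht) (memT_measurable 𝓕 T hρ) hρ.2 (memT_measurable 𝓕 T hτ) hτ.2
  exact this

theorem setInt_split {f g : Ω → ℝ} (hf : Integrable f μ) (hg : Integrable g μ) {A S : Set Ω}
    (hS : MeasurableSet S) (h1 : ∫ ω in A ∩ S, f ω ∂μ ≤ ∫ ω in A ∩ S, g ω ∂μ)
    (h2 : ∫ ω in A \ S, f ω ∂μ ≤ ∫ ω in A \ S, g ω ∂μ) :
    ∫ ω in A, f ω ∂μ ≤ ∫ ω in A, g ω ∂μ := by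
  rw [← integral_inter_add_diff hS hf.integrableOn, ← integral_inter_add_diff hS hg.integrableOn]
  exact add_le_add h1 h2

theorem integral_split {f g : Ω → ℝ} (hf : Integrable f μ) (hg : Integrable g μ) {κ : Ω → ℕ}
    (hκ : Measurable κ) (hκT : ∀ ω, κ ω ≤ T)
    (h : ∀ s ≤ T, ∫ ω in {ω | κ ω = s}, f ω ∂μ ≤ ∫ ω in {ω | κ ω = s}, g ω ∂μ) :
    ∫ ω, f ω ∂μ ≤ ∫ ω, g ω ∂μ := by
  have hU : (⋃ s ∈ Finset.range (T+1), {ω | κ ω = s}) = univ := by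
    ext ω
    simp only [Set.mem_iUnion, Set.mem_univ, iff_true]
    exact ⟨κ ω, Finset.mem_range.2 (Nat.lt_succ_of_le (hκT ω)), rfl⟩
  have key : ∀ f : Ω → ℝ, Integrable f μ →
      ∫ ω, f ω ∂μ = ∑ s ∈ Finset.range (T+1), ∫ ω in {ω | κ ω = s}, f ω ∂μ := by
    intro f hf
    rw [← setIntegral_univ, ← hU]
    apply integral_biUnion_finset
    · intro s _; exact hκ (measurableSet_singleton s)
    · intro s _ t _ hst
      apply Set.disjoint_left.2
      intro ω h1 h2
      exact hst (h1.symm.trans h2)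
    · intro s _; exact hf.integrableOn
  rw [key f hf, key g hg]
  exact Finset.sum_le_sum fun s hs => h s (Nat.lt_succ_iff.1 (Finset.mem_range.1 hs))

theorem dynkinJ_mono {X Y X' Y' : ℕ → Ω → ℝ} (hX : ∀ s ≤ T, Integrable (X s) μ)
    (hY : ∀ s ≤ T, Integrable (Y s) μ) (hX' : ∀ s ≤ T, Integrable (X' s) μ)
    (hY' : ∀ s ≤ T, Integrable (Y' s) μ) {ρ τ : Ω → ℕ} (hρ : MemT 𝓕 T ρ) (hτ : MemT 𝓕 T τ)
    (h1 : ∀ s ≤ T, ∀ A, MeasurableSet[𝓕 s] A → ∫ ω in A, X s ω ∂μ ≤ ∫ ω in A, X' s ω ∂μ)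
    (h2 : ∀ s ≤ T, ∀ A, MeasurableSet[𝓕 s] A → ∫ ω in A, Y s ω ∂μ ≤ ∫ ω in A, Y' s ω ∂μ) :
    ∫ ω, dynkinJ X Y ρ τ ω ∂μ ≤ ∫ ω, dynkinJ X' Y' ρ τ ω ∂μ := by
  have hi := integrable_dynkinJ μ 𝓕 T hX hY hρ hτ
  have hi' := integrable_dynkinJ μ 𝓕 T hX' hY' hρ hτ
  have mρ := memT_measurable 𝓕 T hρ
  have mτ := memT_measurable 𝓕 T hτ
  refine integral_split μ T hi hi' (κ := fun ω => min (ρ ω) (τ ω)) (mρ.min mτ)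
    (fun ω => (min_le_left _ _).trans (hρ.2 ω)) fun s hs => ?_
  refine setInt_split μ hi hi' (S := {ω | ρ ω = s}) (mρ (measurableSet_singleton s)) ?_ ?_
  · have e : {ω | min (ρ ω) (τ ω) = s} ∩ {ω | ρ ω = s} = {ω | ρ ω = s} \ {ω | τ ω < s} := by
      ext ω; simp; omega
    have lt : MeasurableSet[𝓕 s] {ω | τ ω < s} := by
      have := (((memT_iff 𝓕 T τ).1 hτ).1 s).diff (memT_eq 𝓕 T hτ s)
      convert this using 1
      ext ω; simp; omega
    have hA : MeasurableSet[𝓕 s] ({ω | ρ ω = s} \ {ω | τ ω < s}) := (memT_eq 𝓕 T hρ s).diff lt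
    rw [e]
    have c : ∀ X Y : ℕ → Ω → ℝ, ∫ ω in {ω | ρ ω = s} \ {ω | τ ω < s}, dynkinJ X Y ρ τ ω ∂μ
        = ∫ ω in {ω | ρ ω = s} \ {ω | τ ω < s}, X s ω ∂μ := by
      intro X Y
      refine setIntegral_congr_fun (𝓕.le s _ hA) ?_
      rintro ω ⟨ha, hb⟩
      simp only [Set.mem_setOf_eq, not_lt] at ha hb
      simp [dynkinJ, ha, hb]
    rw [c, c]
    exact h1 s hs _ hA
  · have e : {ω | min (ρ ω) (τ ω) = s} \ {ω | ρ ω = s} = {ω | τ ω = s} ∩ {ω | s < ρ ω} := by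
      ext ω; simp; omega
    have hA : MeasurableSet[𝓕 s] ({ω | τ ω = s} ∩ {ω | s < ρ ω}) :=
      (memT_eq 𝓕 T hτ s).inter (memT_gt 𝓕 T hρ s)
    rw [e]
    have c : ∀ X Y : ℕ → Ω → ℝ, ∫ ω in {ω | τ ω = s} ∩ {ω | s < ρ ω}, dynkinJ X Y ρ τ ω ∂μ
        = ∫ ω in {ω | τ ω = s} ∩ {ω | s < ρ ω}, Y s ω ∂μ := by
      intro X Y
      refine setIntegral_congr_fun (𝓕.le s _ hA) ?_
      rintro ω ⟨ha, hb⟩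
      simp only [Set.mem_setOf_eq] at ha hb
      simp [dynkinJ, ha, hb]
    rw [c, c]
    exact h2 s hs _ hA

open Classical in
theorem dynkin_saddle [IsProbabilityMeasure μ] {X Y : ℕ → Ω → ℝ}
    (hX : ∀ s ≤ T, Integrable (X s) μ) (hY : ∀ s ≤ T, Integrable (Y s) μ) (r : ℕ) (hr : r ≤ T)
    (mX : ∀ s, r ≤ s → s ≤ T → Measurable[𝓕 s] (X s))
    (mY : ∀ s, r ≤ s → s ≤ T → Measurable[𝓕 s] (Y s)) :
    ∃ V : Ω → ℝ, ∃ ρ' τ' : Ω → ℕ, Measurable[𝓕 r] V ∧ Integrable V μ ∧ MemTge 𝓕 T r ρ' ∧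
      MemTge 𝓕 T r τ' ∧ ∀ A, MeasurableSet[𝓕 r] A →
      (∀ ρ, MemTge 𝓕 T r ρ → ∫ ω in A, dynkinJ X Y ρ τ' ω ∂μ ≤ ∫ ω in A, V ω ∂μ) ∧
      (∀ τ, MemTge 𝓕 T r τ → ∫ ω in A, V ω ∂μ ≤ ∫ ω in A, dynkinJ X Y ρ' τ ω ∂μ) := by
  revert mX mY
  refine Nat.decreasingInduction' (P := fun r =>
    (∀ s, r ≤ s → s ≤ T → Measurable[𝓕 s] (X s)) → (∀ s, r ≤ s → s ≤ T → Measurable[𝓕 s] (Y s)) →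
    ∃ V : Ω → ℝ, ∃ ρ' τ' : Ω → ℕ, Measurable[𝓕 r] V ∧ Integrable V μ ∧ MemTge 𝓕 T r ρ' ∧
      MemTge 𝓕 T r τ' ∧ ∀ A, MeasurableSet[𝓕 r] A →
      (∀ ρ, MemTge 𝓕 T r ρ → ∫ ω in A, dynkinJ X Y ρ τ' ω ∂μ ≤ ∫ ω in A, V ω ∂μ) ∧
      (∀ τ, MemTge 𝓕 T r τ → ∫ ω in A, V ω ∂μ ≤ ∫ ω in A, dynkinJ X Y ρ' τ ω ∂μ)) ?_ hr ?_
  · intro r hrT _ ih mX mY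
    obtain ⟨V', ρ', τ', mV', iV', hρ', hτ', ih⟩ :=
      ih (fun s h => mX s (by omega)) (fun s h => mY s (by omega))
    set C : Ω → ℝ := μ[V'|𝓕 r] with hC
    have mC : Measurable[𝓕 r] C := stronglyMeasurable_condExp.measurable
    have iC : Integrable C μ := integrable_condExp
    have iX := hX r hrT.le
    have iY := hY r hrT.le
    have mXr := mX r le_rfl hrT.le
    have mYr := mY r le_rfl hrT.le
    have sC : ∀ D, MeasurableSet[𝓕 r] D → ∫ ω in D, C ω ∂μ = ∫ ω in D, V' ω ∂μ := fun D hD =>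
      setIntegral_condExp (𝓕.le r) iV' hD
    let V : Ω → ℝ := fun ω => max (X r ω) (min (Y r ω) (C ω))
    have iV : Integrable V μ := iX.sup (iY.inf iC)
    have mV : Measurable[𝓕 r] V := mXr.max (mYr.min mC)
    let S : Set Ω := {ω | min (Y r ω) (C ω) ≤ X r ω}
    let R : Set Ω := {ω | Y r ω ≤ C ω}
    have hS : MeasurableSet[𝓕 r] S := measurableSet_le (mYr.min mC) mXr
    have hR : MeasurableSet[𝓕 r] R := measurableSet_le mYr mC
    have h1 := memT_ite 𝓕 T hrT.le hρ' hS
    have h2 := memT_ite 𝓕 T hrT.le hτ' hR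
    refine ⟨V, _, _, mV, iV, h1, h2, fun A hA => ⟨fun ρ hρ => ?_, fun τ hτ => ?_⟩⟩
    · have iJ := integrable_dynkinJ μ 𝓕 T hX hY hρ.1 h2.1
      have hB := memT_eq 𝓕 T hρ.1 r
      refine setInt_split μ iJ iV (S := {ω | ρ ω = r}) (𝓕.le r _ hB) ?_ ?_
      · refine setIntegral_mono_on iJ.integrableOn iV.integrableOn (𝓕.le r _ (hA.inter hB)) ?_
        rintro ω ⟨_, hω⟩
        simp only [Set.mem_setOf_eq] at hω
        have := h2.2 ω
        simp only [dynkinJ, hω, if_pos this]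
        exact le_max_left _ _
      refine setInt_split μ iJ iV (S := R) (𝓕.le r _ hR) ?_ ?_
      · refine setIntegral_mono_on iJ.integrableOn iV.integrableOn
          (𝓕.le r _ ((hA.diff hB).inter hR)) ?_
        rintro ω ⟨⟨_, hω⟩, hωR⟩
        simp only [Set.mem_setOf_eq] at hω
        have h3 := hρ.2 ω
        have h4 : ¬ ρ ω ≤ r := by omega
        simp only [dynkinJ, hωR, if_true, h4, if_false]
        have : Y r ω ≤ C ω := hωR
        exact le_max_of_le_right (le_min le_rfl this)
      · have hD : MeasurableSet[𝓕 r] ((A \ {ω | ρ ω = r}) \ R) := (hA.diff hB).diff hR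
        have e : ∫ ω in (A \ {ω | ρ ω = r}) \ R,
            dynkinJ X Y ρ (fun ω => if ω ∈ R then r else τ' ω) ω ∂μ =
            ∫ ω in (A \ {ω | ρ ω = r}) \ R,
              dynkinJ X Y (fun ω => max (ρ ω) (r+1)) τ' ω ∂μ := by
          refine setIntegral_congr_fun (𝓕.le r _ hD) ?_
          rintro ω ⟨⟨_, hω⟩, hωR⟩
          simp only [Set.mem_setOf_eq] at hω
          have h3 := hρ.2 ω
          have h4 : max (ρ ω) (r+1) = ρ ω := by omega
          simp only [dynkinJ, hωR, if_false, h4]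
        rw [e]
        refine ((ih _ (𝓕.mono (Nat.le_succ r) _ hD)).1 _
          ⟨memT_max 𝓕 T hρ.1 (r+1) hrT, fun ω => le_max_right _ _⟩).trans ?_
        rw [← sC _ hD]
        refine setIntegral_mono_on iC.integrableOn iV.integrableOn (𝓕.le r _ hD) ?_
        rintro ω ⟨_, hωR⟩
        have : ¬ Y r ω ≤ C ω := hωR
        exact le_max_of_le_right (le_min (le_of_not_ge this) le_rfl)
    · have iJ := integrable_dynkinJ μ 𝓕 T hX hY h1.1 hτ.1
      have hB := memT_eq 𝓕 T hτ.1 r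
      refine setInt_split μ iV iJ (S := S) (𝓕.le r _ hS) ?_ ?_
      · refine setIntegral_mono_on iV.integrableOn iJ.integrableOn (𝓕.le r _ (hA.inter hS)) ?_
        rintro ω ⟨_, hω⟩
        have h3 := hτ.2 ω
        simp only [dynkinJ, hω, if_true, h3]
        have : min (Y r ω) (C ω) ≤ X r ω := hω
        exact max_le le_rfl this
      refine setInt_split μ iV iJ (S := {ω | τ ω = r}) (𝓕.le r _ hB) ?_ ?_
      · refine setIntegral_mono_on iV.integrableOn iJ.integrableOn
          (𝓕.le r _ ((hA.diff hS).inter hB)) ?_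
        rintro ω ⟨⟨_, hωS⟩, hω⟩
        simp only [Set.mem_setOf_eq] at hω
        have h3 := hρ'.2 ω
        have h4 : ¬ ρ' ω ≤ r := by omega
        simp only [dynkinJ, hωS, if_false, hω, h4]
        have : ¬ min (Y r ω) (C ω) ≤ X r ω := hωS
        have h5 := min_le_left (Y r ω) (C ω)
        exact max_le (by linarith) h5
      · have hD : MeasurableSet[𝓕 r] ((A \ S) \ {ω | τ ω = r}) := (hA.diff hS).diff hB
        have e : ∫ ω in (A \ S) \ {ω | τ ω = r},
            dynkinJ X Y (fun ω => if ω ∈ S then r else ρ' ω) τ ω ∂μ =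
            ∫ ω in (A \ S) \ {ω | τ ω = r},
              dynkinJ X Y ρ' (fun ω => max (τ ω) (r+1)) ω ∂μ := by
          refine setIntegral_congr_fun (𝓕.le r _ hD) ?_
          rintro ω ⟨⟨_, hωS⟩, hω⟩
          simp only [Set.mem_setOf_eq] at hω
          have h3 := hτ.2 ω
          have h4 : max (τ ω) (r+1) = τ ω := by omega
          simp only [dynkinJ, hωS, if_false, h4]
        rw [e]
        refine le_trans ?_ ((ih _ (𝓕.mono (Nat.le_succ r) _ hD)).2 _
          ⟨memT_max 𝓕 T hτ.1 (r+1) hrT, fun ω => le_max_right _ _⟩)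
        rw [← sC _ hD]
        refine setIntegral_mono_on iV.integrableOn iC.integrableOn (𝓕.le r _ hD) ?_
        rintro ω ⟨⟨_, hωS⟩, _⟩
        have : ¬ min (Y r ω) (C ω) ≤ X r ω := hωS
        have h5 := min_le_right (Y r ω) (C ω)
        exact max_le (by linarith) h5
  · intro mX mY
    have hc : MemTge 𝓕 T T (fun _ : Ω => T) := ⟨memT_const 𝓕 T T le_rfl, fun _ => le_rfl⟩
    refine ⟨X T, fun _ => T, fun _ => T, mX T le_rfl le_rfl, hX T le_rfl, hc, hc,
      fun A hA => ⟨fun ρ hρ => ?_, fun τ hτ => ?_⟩⟩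
    · refine le_of_eq (setIntegral_congr_fun (𝓕.le T _ hA) fun ω _ => ?_)
      have : ρ ω = T := le_antisymm (hρ.1.2 ω) (hρ.2 ω)
      simp [dynkinJ, this]
    · refine le_of_eq (setIntegral_congr_fun (𝓕.le T _ hA) fun ω _ => ?_)
      have : τ ω = T := le_antisymm (hτ.1.2 ω) (hτ.2 ω)
      simp [dynkinJ, this]

theorem snell_inf [IsProbabilityMeasure μ] {G : ℕ → Ω → ℝ} (c : ℝ) (hG : ∀ s ω, |G s ω| ≤ c)
    (mG0 : ∀ s, Measurable (G s)) (r : ℕ) (hr : r ≤ T)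
    (mG : ∀ s, r ≤ s → s ≤ T → Measurable[𝓕 s] (G s)) :
    ∃ V : Ω → ℝ, ∃ τ' : Ω → ℕ, Measurable[𝓕 r] V ∧ Integrable V μ ∧ MemTge 𝓕 T r τ' ∧
      ∀ A, MeasurableSet[𝓕 r] A →
      ∫ ω in A, G (τ' ω) ω ∂μ ≤ ∫ ω in A, V ω ∂μ ∧
      (∀ τ, MemTge 𝓕 T r τ → ∫ ω in A, V ω ∂μ ≤ ∫ ω in A, G (τ ω) ω ∂μ) := by
  have iG : ∀ s, Integrable (G s) μ := fun s =>
    Integrable.of_bound (mG0 s).aestronglyMeasurable c (Filter.Eventually.of_forall fun ω => hG s ω)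
  let X : ℕ → Ω → ℝ := fun s => if s < T then fun _ => -c else G s
  have iX : ∀ s ≤ T, Integrable (X s) μ := by
    intro s _
    by_cases h : s < T
    · simp only [X, h, if_true]; exact integrable_const _
    · simp only [X, h, if_false]; exact iG s
  have mX : ∀ s, r ≤ s → s ≤ T → Measurable[𝓕 s] (X s) := by
    intro s h1 h2
    by_cases h : s < T
    · simp only [X, h, if_true]; exact measurable_const
    · simp only [X, h, if_false]; exact mG s h1 h2
  obtain ⟨V, ρ', τ', mV, iV, hρ', hτ', H⟩ :=
    dynkin_saddle μ 𝓕 T iX (fun s _ => iG s) r hr mX mG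
  have iGτ : ∀ τ, MemT 𝓕 T τ → Integrable (fun ω => G (τ ω) ω) μ := fun τ hτ =>
    integrable_comp μ T (fun s _ => G s) (fun s _ _ _ => iG s) (memT_measurable 𝓕 T hτ) hτ.2
      (memT_measurable 𝓕 T hτ) hτ.2
  refine ⟨V, τ', mV, iV, hτ', fun A hA => ⟨?_, fun τ hτ => ?_⟩⟩
  · refine le_trans (le_of_eq ?_)
      ((H A hA).1 (fun _ => T) ⟨memT_const 𝓕 T T le_rfl, fun _ => hr⟩)
    refine setIntegral_congr_fun (𝓕.le r _ hA) fun ω _ => ?_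
    have h := hτ'.1.2 ω
    by_cases h1 : T ≤ τ' ω
    · have h2 : τ' ω = T := le_antisymm h h1
      simp [dynkinJ, X, h2]
    · simp [dynkinJ, h1]
  · refine ((H A hA).2 τ hτ).trans ?_
    refine setIntegral_mono_on (integrable_dynkinJ μ 𝓕 T iX (fun s _ => iG s) hρ'.1
      hτ.1).integrableOn (iGτ τ hτ.1).integrableOn (𝓕.le r _ hA) fun ω _ => ?_
    by_cases h1 : ρ' ω ≤ τ ω
    · by_cases h2 : ρ' ω < T
      · simp only [dynkinJ, h1, if_true, X, h2]
        exact (abs_le.1 (hG (τ ω) ω)).1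
      · have h3 := hτ.1.2 ω
        have h4 : ρ' ω = τ ω := by omega
        simp only [dynkinJ, h1, if_true, X, h2, if_false]
        rw [h4]
    · simp only [dynkinJ, h1, if_false]
      exact le_rfl

theorem snell_sup [IsProbabilityMeasure μ] {G : ℕ → Ω → ℝ} (c : ℝ) (hG : ∀ s ω, |G s ω| ≤ c)
    (mG0 : ∀ s, Measurable (G s)) (r : ℕ) (hr : r ≤ T)
    (mG : ∀ s, r ≤ s → s ≤ T → Measurable[𝓕 s] (G s)) :
    ∃ V : Ω → ℝ, ∃ τ' : Ω → ℕ, Measurable[𝓕 r] V ∧ Integrable V μ ∧ MemTge 𝓕 T r τ' ∧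
      ∀ A, MeasurableSet[𝓕 r] A →
      ∫ ω in A, V ω ∂μ ≤ ∫ ω in A, G (τ' ω) ω ∂μ ∧
      (∀ τ, MemTge 𝓕 T r τ → ∫ ω in A, G (τ ω) ω ∂μ ≤ ∫ ω in A, V ω ∂μ) := by
  obtain ⟨V, τ', mV, iV, hτ', H⟩ := snell_inf μ 𝓕 T (G := fun s ω => - G s ω) c
    (fun s ω => by rw [abs_neg]; exact hG s ω) (fun s => (mG0 s).neg) r hr
    (fun s h1 h2 => (mG s h1 h2).neg)
  refine ⟨fun ω => - V ω, τ', mV.neg, iV.neg, hτ', fun A hA => ⟨?_, fun τ hτ => ?_⟩⟩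
  · have := (H A hA).1
    rw [integral_neg] at this ⊢
    linarith
  · have := (H A hA).2 τ hτ
    rw [integral_neg] at this ⊢
    linarith

theorem w_eq (U : ℕ → ℕ → Ω → ℝ) (ρ τ : (Ω → ℕ) × (ℕ → Ω → ℕ)) :
    w μ U ρ τ = ∫ ω, dynkinJ (fun s ω => U s (τ.2 s ω) ω) (fun t ω => U (ρ.2 t ω) t ω)
      ρ.1 τ.1 ω ∂μ := by
  unfold w
  congr 1
  funext ω
  by_cases h : ρ.1 ω ≤ τ.1 ω
  · have h' : ¬ τ.1 ω < ρ.1 ω := not_lt.2 h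
    simp only [adjA, adjB, dynkinJ, h, h', if_true, if_false]
  · have h' : τ.1 ω < ρ.1 ω := not_le.1 h
    simp only [adjA, adjB, dynkinJ, h, h', if_true, if_false]

theorem game_saddle [IsProbabilityMeasure μ] (U : ℕ → ℕ → Ω → ℝ)
    (hUm : ∀ s t, Measurable[𝓕 (max s t)] (U s t)) (c : ℝ) (hUb : ∀ s t ω, |U s t ω| ≤ c) :
    ∃ v : ℝ, ∃ ρ' τ' : (Ω → ℕ) × (ℕ → Ω → ℕ), MemSA 𝓕 T ρ' ∧ MemSB 𝓕 T τ' ∧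
      (∀ ρ, MemSA 𝓕 T ρ → w μ U ρ τ' ≤ v) ∧ (∀ τ, MemSB 𝓕 T τ → v ≤ w μ U ρ' τ) := by
  have mU : ∀ s t, Measurable (U s t) := fun s t => (hUm s t).mono (𝓕.le _) le_rfl
  have iU : ∀ s t, Integrable (U s t) μ := fun s t =>
    Integrable.of_bound (mU s t).aestronglyMeasurable c
      (Filter.Eventually.of_forall fun ω => hUb s t ω)
  have hXex : ∀ s, ∃ V : Ω → ℝ, ∃ τ' : Ω → ℕ, s ≤ T → Measurable[𝓕 s] V ∧ Integrable V μ ∧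
      MemTge 𝓕 T s τ' ∧ ∀ A, MeasurableSet[𝓕 s] A →
      ∫ ω in A, U s (τ' ω) ω ∂μ ≤ ∫ ω in A, V ω ∂μ ∧
      (∀ τ, MemTge 𝓕 T s τ → ∫ ω in A, V ω ∂μ ≤ ∫ ω in A, U s (τ ω) ω ∂μ) := by
    intro s
    by_cases hs : s ≤ T
    · obtain ⟨V, τ', h⟩ := snell_inf μ 𝓕 T (G := U s) c (hUb s) (mU s) s hs (fun t ht _ => by
        have := hUm s t
        rwa [max_eq_right ht] at this)
      exact ⟨V, τ', fun _ => h⟩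
    · exact ⟨0, 0, fun h => absurd h hs⟩
  have hYex : ∀ t, ∃ V : Ω → ℝ, ∃ τ' : Ω → ℕ, t ≤ T → Measurable[𝓕 t] V ∧ Integrable V μ ∧
      MemTgePlus 𝓕 T t τ' ∧ ∀ A, MeasurableSet[𝓕 t] A →
      ∫ ω in A, V ω ∂μ ≤ ∫ ω in A, U (τ' ω) t ω ∂μ ∧
      (∀ τ, MemTgePlus 𝓕 T t τ → ∫ ω in A, U (τ ω) t ω ∂μ ≤ ∫ ω in A, V ω ∂μ) := by
    intro t
    by_cases ht : t ≤ T
    · have htr : t ≤ min (t+1) T := le_min (Nat.le_succ t) ht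
      obtain ⟨V, τ', mV, iV, hτ', H⟩ := snell_sup μ 𝓕 T (G := fun s => U s t) c
        (fun s => hUb s t) (fun s => mU s t) (min (t+1) T) (min_le_right _ _) (fun s hs _ => by
          have := hUm s t
          rwa [max_eq_left (htr.trans hs)] at this)
      refine ⟨μ[V|𝓕 t], τ', fun _ => ⟨stronglyMeasurable_condExp.measurable, integrable_condExp,
        hτ', fun A hA => ?_⟩⟩
      rw [setIntegral_condExp (𝓕.le t) iV hA]
      exact H A (𝓕.mono htr _ hA)
    · exact ⟨0, 0, fun h => absurd h ht⟩
  choose X τ1 hX using hXex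
  choose Y ρ1 hY using hYex
  have iX : ∀ s ≤ T, Integrable (X s) μ := fun s hs => (hX s hs).2.1
  have iY : ∀ s ≤ T, Integrable (Y s) μ := fun s hs => (hY s hs).2.1
  obtain ⟨V, ρ0, τ0, -, -, hρ0, hτ0, H⟩ := dynkin_saddle μ 𝓕 T iX iY 0 (Nat.zero_le T)
    (fun s _ hs => (hX s hs).1) (fun s _ hs => (hY s hs).1)
  have H := H univ MeasurableSet.univ
  simp only [setIntegral_univ] at H
  have iUs : ∀ s ≤ T, ∀ τ, MemT 𝓕 T τ → Integrable (fun ω => U s (τ ω) ω) μ := fun s hs τ hτ =>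
    integrable_comp μ T (fun _ t => U s t) (fun _ _ t _ => iU s t) (memT_measurable 𝓕 T hτ) hτ.2
      (memT_measurable 𝓕 T hτ) hτ.2
  have iUt : ∀ t ≤ T, ∀ τ, MemT 𝓕 T τ → Integrable (fun ω => U (τ ω) t ω) μ := fun t ht τ hτ =>
    integrable_comp μ T (fun _ s => U s t) (fun _ _ s _ => iU s t) (memT_measurable 𝓕 T hτ) hτ.2
      (memT_measurable 𝓕 T hτ) hτ.2
  refine ⟨∫ ω, V ω ∂μ, (ρ0, ρ1), (τ0, τ1), ⟨hρ0.1, fun t ht => (hY t ht).2.2.1⟩,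
    ⟨hτ0.1, fun t ht => (hX t ht).2.2.1⟩, fun ρ hρ => ?_, fun τ hτ => ?_⟩
  · rw [w_eq]
    refine le_trans ?_ (H.1 ρ.1 ⟨hρ.1, fun _ => Nat.zero_le _⟩)
    exact dynkinJ_mono μ 𝓕 T (fun s hs => iUs s hs _ (hX s hs).2.2.1.1)
      (fun t ht => iUt t ht _ (hρ.2 t ht).1) iX iY hρ.1 hτ0.1
      (fun s hs A hA => ((hX s hs).2.2.2 A hA).1)
      (fun t ht A hA => ((hY t ht).2.2.2 A hA).2 _ (hρ.2 t ht))
  · rw [w_eq]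
    refine le_trans (H.2 τ.1 ⟨hτ.1, fun _ => Nat.zero_le _⟩) ?_
    exact dynkinJ_mono μ 𝓕 T iX iY (fun s hs => iUs s hs _ (hτ.2 s hs).1)
      (fun t ht => iUt t ht _ (hY t ht).2.2.1.1) hρ0.1 hτ.1
      (fun s hs A hA => ((hX s hs).2.2.2 A hA).2 _ (hτ.2 s hs))
      (fun t ht A hA => ((hY t ht).2.2.2 A hA).1)

/-- the zero-sum sequential-move stopping game has a value:
`sup_{ρ ∈ 𝔗^a} inf_{τ ∈ 𝔗^b} E[U(ρ⟨τ⟩,τ⟨ρ⟩)] = inf_{τ ∈ 𝔗^b} sup_{ρ ∈ 𝔗^a} E[U(ρ⟨τ⟩,τ⟨ρ⟩)]`. -/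
theorem zero_sum_game_has_value
    [MeasurableSpace.CountablyGenerated Ω] [IsProbabilityMeasure μ]
    (U : ℕ → ℕ → Ω → ℝ)
    (hUm : ∀ s t, Measurable[𝓕 (max s t)] (U s t))
    (hUb : ∃ C, ∀ s t ω, |U s t ω| ≤ C) :
    sSup {x : ℝ | ∃ ρ : (Ω → ℕ) × (ℕ → Ω → ℕ), MemSA 𝓕 T ρ ∧
        x = sInf {y : ℝ | ∃ τ : (Ω → ℕ) × (ℕ → Ω → ℕ), MemSB 𝓕 T τ ∧ y = w μ U ρ τ}} =
    sInf {x : ℝ | ∃ τ : (Ω → ℕ) × (ℕ → Ω → ℕ), MemSB 𝓕 T τ ∧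
        x = sSup {y : ℝ | ∃ ρ : (Ω → ℕ) × (ℕ → Ω → ℕ), MemSA 𝓕 T ρ ∧ y = w μ U ρ τ}} := by
  obtain ⟨c, hc⟩ := hUb
  obtain ⟨v, ρ', τ', hρ', hτ', h1, h2⟩ := game_saddle μ 𝓕 T U hUm c hc
  have hw : ∀ ρ τ, |w μ U ρ τ| ≤ c := by
    intro ρ τ
    have := norm_integral_le_of_norm_le_const (μ := μ) (C := c)
      (f := fun ω => U (adjA ρ τ ω) (adjB τ ρ ω) ω)
      (Filter.Eventually.of_forall fun ω => hc _ _ ω)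
    simpa [w] using this
  have bI : ∀ ρ, BddBelow {y : ℝ | ∃ τ : (Ω → ℕ) × (ℕ → Ω → ℕ), MemSB 𝓕 T τ ∧ y = w μ U ρ τ} := by
    rintro ρ
    refine ⟨-c, ?_⟩
    rintro y ⟨τ, _, rfl⟩
    exact (abs_le.1 (hw ρ τ)).1
  have bS : ∀ τ, BddAbove {y : ℝ | ∃ ρ : (Ω → ℕ) × (ℕ → Ω → ℕ), MemSA 𝓕 T ρ ∧ y = w μ U ρ τ} := by
    rintro τ
    refine ⟨c, ?_⟩
    rintro y ⟨ρ, _, rfl⟩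
    exact (abs_le.1 (hw ρ τ)).2
  have e1 : IsGreatest {x : ℝ | ∃ ρ : (Ω → ℕ) × (ℕ → Ω → ℕ), MemSA 𝓕 T ρ ∧
        x = sInf {y : ℝ | ∃ τ : (Ω → ℕ) × (ℕ → Ω → ℕ), MemSB 𝓕 T τ ∧ y = w μ U ρ τ}} v := by
    have ub : ∀ ρ, MemSA 𝓕 T ρ →
        sInf {y : ℝ | ∃ τ : (Ω → ℕ) × (ℕ → Ω → ℕ), MemSB 𝓕 T τ ∧ y = w μ U ρ τ} ≤ v :=
      fun ρ hρ => (csInf_le (bI ρ) ⟨τ', hτ', rfl⟩).trans (h1 ρ hρ)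
    refine ⟨⟨ρ', hρ', le_antisymm ?_ (ub ρ' hρ')⟩, ?_⟩
    · refine le_csInf ⟨_, τ', hτ', rfl⟩ ?_
      rintro y ⟨τ, hτ, rfl⟩
      exact h2 τ hτ
    · rintro x ⟨ρ, hρ, rfl⟩
      exact ub ρ hρ
  have e2 : IsLeast {x : ℝ | ∃ τ : (Ω → ℕ) × (ℕ → Ω → ℕ), MemSB 𝓕 T τ ∧
        x = sSup {y : ℝ | ∃ ρ : (Ω → ℕ) × (ℕ → Ω → ℕ), MemSA 𝓕 T ρ ∧ y = w μ U ρ τ}} v := by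
    have lb : ∀ τ, MemSB 𝓕 T τ →
        v ≤ sSup {y : ℝ | ∃ ρ : (Ω → ℕ) × (ℕ → Ω → ℕ), MemSA 𝓕 T ρ ∧ y = w μ U ρ τ} :=
      fun τ hτ => (h2 τ hτ).trans (le_csSup (bS τ) ⟨ρ', hρ', rfl⟩)
    refine ⟨⟨τ', hτ', le_antisymm (lb τ' hτ') ?_⟩, ?_⟩
    · refine csSup_le ⟨_, ρ', hρ', rfl⟩ ?_
      rintro y ⟨ρ, hρ, rfl⟩
      exact h1 ρ hρ
    · rintro x ⟨τ, hτ, rfl⟩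
      exact lb τ hτ
  rw [e1.csSup_eq, e2.csInf_eq]

end
end

section
/- The value process of the discrete-time Dynkin game stopped at the maximizer's optimal stopping time is a submartingale: with ρ_0 := inf{t ≥ 0 : v_t = F_t}, the process (v_{t∧ρ_0})_{t=0,…,T} is a submartingale with respect to (𝓕_t). -/
open MeasureTheory Set

section

variable {Ω : Type*} {m0 : MeasurableSpace Ω} (μ : Measure Ω) (𝓕 : Filtration ℕ m0) (T : ℕ)

/-- the value process of the discrete-time Dynkin game stopped at
the maximizer's optimal stopping time `ρ₀ = inf{t ≥ 0 : v_t = F_t}` is a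
submartingale. -/
theorem dynkin_value_stopped_submartingale
    [IsProbabilityMeasure μ]
    (F G v : ℕ → Ω → ℝ)
    (hFad : ∀ t, Measurable[𝓕 t] (F t)) (hGad : ∀ t, Measurable[𝓕 t] (G t))
    (hFb : ∃ C, ∀ t ω, |F t ω| ≤ C) (hGb : ∃ C, ∀ t ω, |G t ω| ≤ C)
    (hFG : ∀ t, F t ≤ᵐ[μ] G t)
    (hvT : v T = F T)
    (hvrec : ∀ t < T, v t = fun ω => max (F t ω) (min (G t ω) ((μ[v (t + 1) | 𝓕 t]) ω)))
    (ρ0 : Ω → ℕ) (hρ0 : ρ0 = hitTime T (fun _ => 0) (fun t ω => v t ω = F t ω)) :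
    Submartingale (MeasureTheory.stoppedProcess v (fun ω => (ρ0 ω : WithTop ℕ))) 𝓕 μ := by
  classical
  have hρT : ∀ ω, ρ0 ω ≤ T := fun ω => by
    rw [hρ0]; exact Nat.sInf_le (Or.inr rfl)
  have hρle : ∀ i ω, ρ0 ω ≤ i ↔ T ≤ i ∨ ∃ t ≤ i, v t ω = F t ω := by
    intro i ω
    constructor
    · intro h
      have hm : ρ0 ω ∈ ({t | 0 ≤ t ∧ v t ω = F t ω} ∪ {T} : Set ℕ) := by
        rw [hρ0]; exact Nat.sInf_mem ⟨T, Or.inr rfl⟩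
      rcases hm with hm | hm
      · exact Or.inr ⟨_, h, hm.2⟩
      · left
        have : ρ0 ω = T := hm
        omega
    · rintro (h | ⟨t, ht, hv⟩)
      · exact (hρT ω).trans h
      · refine le_trans ?_ ht
        rw [hρ0]; exact Nat.sInf_le (Or.inl ⟨Nat.zero_le _, hv⟩)
  have hvm : ∀ t ≤ T, Measurable[𝓕 t] (v t) := by
    intro t ht
    rcases ht.lt_or_eq with h | h
    · rw [hvrec t h]
      exact (hFad t).max ((hGad t).min stronglyMeasurable_condExp.measurable)
    · subst h; rw [hvT]; exact hFad _
  obtain ⟨C, hC⟩ := hFb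
  obtain ⟨D, hD⟩ := hGb
  have hvb : ∀ t ≤ T, ∀ ω, |v t ω| ≤ max C D := by
    intro t ht ω
    rcases ht.lt_or_eq with h | h
    · rw [hvrec t h]
      have h1 := abs_le.1 (hC t ω)
      have h2 := abs_le.1 (hD t ω)
      have h3 := le_max_left C D
      have h4 := le_max_right C D
      refine abs_le.2 ⟨?_, ?_⟩
      · exact le_trans (by linarith) (le_max_left _ _)
      · exact max_le (by linarith) ((min_le_left _ _).trans (by linarith))
    · subst h; rw [hvT]; exact (hC _ ω).trans (le_max_left _ _)
  set w : ℕ → Ω → ℝ := fun t => v (min t T) with hw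
  have hwm : StronglyAdapted 𝓕 w := fun t =>
    ((hvm _ (min_le_right t T)).mono (𝓕.mono (min_le_left t T)) le_rfl).stronglyMeasurable
  have hwi : ∀ t, Integrable (w t) μ := fun t =>
    Integrable.of_bound ((hwm t).mono (𝓕.le t)).aestronglyMeasurable (max C D)
      (Filter.Eventually.of_forall fun ω => hvb _ (min_le_right t T) ω)
  have hst : IsStoppingTime 𝓕 (fun ω => (ρ0 ω : WithTop ℕ)) := by
    intro i
    have he : {ω | (ρ0 ω : WithTop ℕ) ≤ (i : WithTop ℕ)} = {ω | ρ0 ω ≤ i} := by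
      ext ω; exact WithTop.coe_le_coe
    change MeasurableSet[𝓕 i] {ω | (ρ0 ω : WithTop ℕ) ≤ (i : WithTop ℕ)}
    rw [he]
    by_cases hi : T ≤ i
    · have : {ω | ρ0 ω ≤ i} = Set.univ := by
        ext ω; simp [(hρT ω).trans hi]
      rw [this]; exact MeasurableSet.univ
    · have : {ω | ρ0 ω ≤ i} = ⋃ t, ⋃ (_ : t ≤ i), {ω | v t ω = F t ω} := by
        ext ω; simp [hρle, hi]
      rw [this]
      refine MeasurableSet.iUnion fun t => MeasurableSet.iUnion fun ht => ?_
      refine 𝓕.mono ht _ ?_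
      exact measurableSet_eq_fun (hvm t (by omega)) (hFad t)
  have hS : ∀ (u : ℕ → Ω → ℝ) i ω, stoppedProcess u (fun ω => (ρ0 ω : WithTop ℕ)) i ω
      = u (min i (ρ0 ω)) ω := by
    intro u i ω
    rcases le_total i (ρ0 ω) with h | h
    · rw [stoppedProcess_eq_of_le (τ := fun ω => (ρ0 ω : WithTop ℕ)) (WithTop.coe_le_coe.2 h), min_eq_left h]
    · rw [stoppedProcess_eq_of_ge (τ := fun ω => (ρ0 ω : WithTop ℕ)) (WithTop.coe_le_coe.2 h), min_eq_right h]
      rfl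
  have hvw : stoppedProcess v (fun ω => (ρ0 ω : WithTop ℕ))
      = stoppedProcess w (fun ω => (ρ0 ω : WithTop ℕ)) := by
    funext i ω
    rw [hS, hS, hw]
    simp only
    rw [min_eq_left ((min_le_right _ _).trans (hρT ω))]
  rw [hvw]
  refine submartingale_of_condExp_sub_nonneg_nat (hwm.stoppedProcess_of_discrete hst)
    (fun i => integrable_stoppedProcess hst hwi i) fun i => ?_
  have hA : MeasurableSet[𝓕 i] {ω | i < ρ0 ω} := by
    have h := (hst i).compl
    convert h using 1
    ext ω
    simp
  have hd : stoppedProcess w (fun ω => (ρ0 ω : WithTop ℕ)) (i + 1)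
      - stoppedProcess w (fun ω => (ρ0 ω : WithTop ℕ)) i
      = {ω | i < ρ0 ω}.indicator (w (i + 1) - w i) := by
    funext ω
    rw [Pi.sub_apply, hS, hS]
    by_cases h : i < ρ0 ω
    · rw [Set.indicator_of_mem (by exact h), min_eq_left h.le, min_eq_left (by omega)]
      rfl
    · rw [Set.indicator_of_notMem (by exact h), min_eq_right (by omega), min_eq_right (by omega),
        sub_self]
  rw [hd]
  have h1 := condExp_indicator (m := 𝓕 i) ((hwi (i + 1)).sub (hwi i)) hA
  have h2 := condExp_sub (hwi (i + 1)) (hwi i) (𝓕 i)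
  have h3 := condExp_of_stronglyMeasurable (𝓕.le i) (hwm i) (hwi i)
  filter_upwards [h1, h2] with ω e1 e2
  rw [e1]
  by_cases h : i < ρ0 ω
  · rw [Set.indicator_of_mem (by exact h), e2, Pi.sub_apply, h3]
    have hiT : i < T := h.trans_le (hρT ω)
    have hw1 : w (i + 1) = v (i + 1) := by simp only [hw]; rw [min_eq_left (by omega)]
    have hw0 : w i = v i := by simp only [hw]; rw [min_eq_left (by omega)]
    have hne : v i ω ≠ F i ω := fun hh => absurd ((hρle i ω).2 (Or.inr ⟨i, le_rfl, hh⟩)) (by omega)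
    rw [hw1, hw0]
    have hv := congrFun (hvrec i hiT) ω
    rcases max_choice (F i ω) (min (G i ω) ((μ[v (i + 1) | 𝓕 i]) ω)) with hm | hm
    · exact absurd (hv.trans hm) hne
    · have := min_le_right (G i ω) ((μ[v (i + 1) | 𝓕 i]) ω)
      simp only [Pi.zero_apply]
      linarith
  · rw [Set.indicator_of_notMem (by exact h)]
    exact le_rfl

end
end

section
/- The value process of the discrete-time Dynkin game stopped at the minimizer's optimal stopping time is a supermartingale: with τ_0 := inf{t ≥ 0 : v_t = G_t} (convention inf ∅ := T), the process (v_{t∧τ_0})_{t=0,…,T} is a supermartingale with respect to (𝓕_t). -/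
open MeasureTheory Set

section

variable {Ω : Type*} {m0 : MeasurableSpace Ω} (μ : Measure Ω) (𝓕 : Filtration ℕ m0) (T : ℕ)

/-- the value process of the discrete-time Dynkin game stopped at
the minimizer's optimal stopping time `τ₀ = inf{t ≥ 0 : v_t = G_t}` (with the
convention `inf ∅ := T`) is a supermartingale. -/
theorem dynkin_value_stopped_supermartingale
    [IsProbabilityMeasure μ]
    (F G v : ℕ → Ω → ℝ)
    (hFad : ∀ t, Measurable[𝓕 t] (F t)) (hGad : ∀ t, Measurable[𝓕 t] (G t))
    (hFb : ∃ C, ∀ t ω, |F t ω| ≤ C) (hGb : ∃ C, ∀ t ω, |G t ω| ≤ C)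
    (hFG : ∀ t, F t ≤ᵐ[μ] G t)
    (hvT : v T = F T)
    (hvrec : ∀ t < T, v t = fun ω => max (F t ω) (min (G t ω) ((μ[v (t + 1) | 𝓕 t]) ω)))
    (τ0 : Ω → ℕ) (hτ0 : τ0 = hitTime T (fun _ => 0) (fun t ω => v t ω = G t ω)) :
    Supermartingale (MeasureTheory.stoppedProcess v (fun ω => (τ0 ω : WithTop ℕ))) 𝓕 μ := by
  obtain ⟨CF, hCF⟩ := hFb
  obtain ⟨CG, hCG⟩ := hGb
  -- adaptedness and boundedness of `v` up to time `T`
  have hvmeas : ∀ t ≤ T, Measurable[𝓕 t] (v t) := by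
    intro t ht
    rcases ht.lt_or_eq with h | h
    · rw [hvrec t h]
      exact (hFad t).max ((hGad t).min stronglyMeasurable_condExp.measurable)
    · subst h
      rw [hvT]
      exact hFad t
  have hvb : ∀ t ≤ T, ∀ ω, |v t ω| ≤ max CF CG := by
    intro t ht ω
    have h1 := abs_le.mp (hCF t ω)
    have h2 := abs_le.mp (hCG t ω)
    have h3 := le_max_left CF CG
    have h4 := le_max_right CF CG
    rcases ht.lt_or_eq with h | h
    · rw [hvrec t h]
      refine abs_le.mpr ⟨?_, ?_⟩
      · exact le_trans (by linarith) (le_max_left _ _)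
      · exact max_le (by linarith) ((min_le_left _ _).trans (by linarith))
    · subst h
      rw [hvT]
      exact (hCF t ω).trans h3
  have hvint : ∀ t ≤ T, Integrable (v t) μ := fun t ht =>
    Integrable.of_bound ((hvmeas t ht).mono (𝓕.le t) le_rfl).aestronglyMeasurable (max CF CG)
      (Filter.Eventually.of_forall fun ω => by
        rw [Real.norm_eq_abs]; exact hvb t ht ω)
  have hτT : ∀ ω, τ0 ω ≤ T := by
    intro ω
    rw [hτ0]
    exact Nat.sInf_le (Or.inr rfl)
  have hlt : ∀ t ω, t < τ0 ω ↔ t < T ∧ ∀ s ≤ t, v s ω ≠ G s ω := by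
    intro t ω
    constructor
    · intro h
      refine ⟨h.trans_le (hτT ω), fun s hs he => ?_⟩
      have : τ0 ω ≤ s := by
        rw [hτ0]
        exact Nat.sInf_le (Or.inl ⟨Nat.zero_le _, he⟩)
      omega
    · rintro ⟨h1, h2⟩
      have hm : τ0 ω ∈ ({t | 0 ≤ t ∧ v t ω = G t ω} ∪ {T} : Set ℕ) := by
        rw [hτ0]
        exact Nat.sInf_mem ⟨T, Or.inr rfl⟩
      by_contra hc
      rcases hm with hm | hm
      · exact h2 _ (by omega) hm.2
      · have : τ0 ω = T := hm
        omega
  have hA : ∀ t, MeasurableSet[𝓕 t] {ω | t < τ0 ω} := by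
    intro t
    by_cases h : t < T
    · have : {ω | t < τ0 ω} = ⋂ s, ⋂ (_ : s ≤ t), {ω | v s ω = G s ω}ᶜ := by
        ext ω
        simp [hlt, h]
      rw [this]
      refine MeasurableSet.iInter fun s => MeasurableSet.iInter fun hs => ?_
      refine MeasurableSet.compl ?_
      exact 𝓕.mono hs _ (measurableSet_eq_fun (m := 𝓕 s)
        (hvmeas s (by omega)) (hGad s))
    · have : {ω | t < τ0 ω} = ∅ := by
        ext ω
        simp [hlt, h]
      rw [this]
      exact @MeasurableSet.empty _ (𝓕 t)
  set X := MeasureTheory.stoppedProcess v (fun ω => (τ0 ω : WithTop ℕ)) with hX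
  have hXe : ∀ t ω, X t ω = v (min t (τ0 ω)) ω := by
    intro t ω
    rw [hX]
    simp only [MeasureTheory.stoppedProcess]
    congr 1
  have hstep : ∀ t, X t - X (t + 1) = {ω | t < τ0 ω}.indicator (v t - v (t + 1)) := by
    intro t
    ext ω
    by_cases h : t < τ0 ω
    · simp [hXe, Set.indicator, h, min_eq_left h.le, min_eq_left (Nat.succ_le_of_lt h)]
    · have h' : τ0 ω ≤ t := not_lt.mp h
      simp [hXe, Set.indicator, h, min_eq_right h', min_eq_right (h'.trans (Nat.le_succ t))]
  have hAe : ∀ t, ¬ t < T → {ω | t < τ0 ω} = ∅ := by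
    intro t h
    ext ω
    simp [hlt, h]
  have hXm : ∀ t, Measurable[𝓕 t] (X t) := by
    intro t
    induction t with
    | zero =>
      have : X 0 = v 0 := by
        ext ω
        simp [hXe]
      rw [this]
      exact hvmeas 0 (Nat.zero_le _)
    | succ t ih =>
      have hm := 𝓕.mono (Nat.le_succ t)
      have e : X (t + 1) = X t - {ω | t < τ0 ω}.indicator (v t - v (t + 1)) := by
        rw [← hstep]
        abel
      rw [e]
      by_cases h : t < T
      · refine (ih.mono hm le_rfl).sub (Measurable.indicator ?_ (hm _ (hA t)))
        exact ((hvmeas t h.le).mono hm le_rfl).sub (hvmeas (t + 1) h)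
      · rw [hAe t h, Set.indicator_empty]
        exact (ih.mono hm le_rfl).sub measurable_const
  refine supermartingale_of_condExp_sub_nonneg_nat (fun t => (hXm t).stronglyMeasurable) ?_ ?_
  · intro t
    refine Integrable.of_bound ((hXm t).mono (𝓕.le t) le_rfl).aestronglyMeasurable (max CF CG)
      (Filter.Eventually.of_forall fun ω => ?_)
    rw [Real.norm_eq_abs, hXe]
    exact hvb _ ((min_le_right _ _).trans (hτT ω)) ω
  · intro t
    rw [hstep]
    by_cases h : t < T
    · have i1 := hvint t h.le
      have i2 := hvint (t + 1) h
      have c1 := condExp_indicator (m := 𝓕 t) (i1.sub i2) (hA t)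
      have c2 := condExp_sub i1 i2 (𝓕 t)
      have c3 := condExp_of_stronglyMeasurable (𝓕.le t) (hvmeas t h.le).stronglyMeasurable i1
      filter_upwards [c1, c2, hFG t] with ω h1 h2 h3
      rw [h1]
      by_cases hω : t < τ0 ω
      · have hne := ((hlt t ω).mp hω).2 t le_rfl
        rw [Set.indicator_of_mem (by exact hω), h2, Pi.sub_apply, c3]
        have hv := congrFun (hvrec t h) ω
        simp only [Pi.zero_apply, sub_nonneg]
        rcases le_total (G t ω) ((μ[v (t + 1) | 𝓕 t]) ω) with h5 | h5
        · rw [min_eq_left h5, max_eq_right h3] at hv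
          exact absurd hv hne
        · rw [min_eq_right h5] at hv
          rw [hv]
          exact le_max_right _ _
      · rw [Set.indicator_of_notMem (by exact hω)]
        simp
    · rw [hAe t h, Set.indicator_empty]
      have : (μ[(fun _ => (0 : ℝ)) | 𝓕 t]) = 0 := condExp_zero
      rw [this]

end
end
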